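/- Realizer lemma for μ-abstraction: for any pole ⊥⊥, any simple type A of the λ̄[lvτ⋆]-calculus, any closed store τ, any context variable α and command c with FV(μα.c)⊆dom(τ), if for every catchable context-in-store (E|τ′) ∈ ‖A‖_E with τ ◇ τ′ the closure c(τ̄τ′)[α:=E] belongs to ⊥⊥, then (μα.c|τ) ∈ |A|_t. -/

import Mathlib

namespace LLV

/-- Simple types: atomic types (indexed by naturals) and arrows. -/
inductive Ty : Type
  | atom : ℕ → Ty
  | arrow : Ty → Ty → Ty
deriving DecidableEq

/- Syntax of the λ̄[lvτ⋆]-calculus, by mutual induction. -/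
mutual
/-- Strong values v ::= λx.t | 𝐤 -/
inductive SVal : Type
  | lam : ℕ → Trm → SVal
  | const : ℕ → SVal
/-- Weak values V ::= v | x -/
inductive WVal : Type
  | sval : SVal → WVal
  | var : ℕ → WVal
/-- Terms t ::= V | μα.c -/
inductive Trm : Type
  | wval : WVal → Trm
  | mu : ℕ → Cmd → Trm
/-- Forcing contexts F ::= t·E | 𝛋 -/
inductive FCtx : Type
  | app : Trm → CCtx → FCtx
  | coconst : ℕ → FCtx
/-- Catchable contexts E ::= F | α | μ̃[x].⟨x‖F⟩τ -/
inductive CCtx : Type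
  | fctx : FCtx → CCtx
  | covar : ℕ → CCtx
  | mutil : ℕ → FCtx → Store → CCtx
/-- Evaluation contexts e ::= E | μ̃x.c -/
inductive ECtx : Type
  | cctx : CCtx → ECtx
  | mut : ℕ → Cmd → ECtx
/-- Commands c ::= ⟨t‖e⟩ -/
inductive Cmd : Type
  | cut : Trm → ECtx → Cmd
/-- Stores τ ::= ε | τ[x:=t] | τ[α:=E] -/
inductive Store : Type
  | nil : Store
  | consT : Store → ℕ → Trm → Store
  | consE : Store → ℕ → CCtx → Store
end

/-- Coercion: weak value to term. -/
def ofW (V : WVal) : Trm := .wval V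
/-- Coercion: strong value to term. -/
def ofS (v : SVal) : Trm := .wval (.sval v)
/-- Coercion: catchable context to evaluation context. -/
def ofC (E : CCtx) : ECtx := .cctx E
/-- Coercion: forcing context to evaluation context. -/
def ofF (F : FCtx) : ECtx := .cctx (.fctx F)

/-- Domain of a store: the set of (co-)variables it binds
(term variables on the left, context variables on the right). -/
def Store.dom : Store → Finset (ℕ ⊕ ℕ)
  | .nil => ∅
  | .consT τ x _ => insert (Sum.inl x) τ.dom
  | .consE τ α _ => insert (Sum.inr α) τ.dom

mutual
def SVal.fv : SVal → Finset (ℕ ⊕ ℕ)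
  | .lam x t => t.fv \ {Sum.inl x}
  | .const _ => ∅
def WVal.fv : WVal → Finset (ℕ ⊕ ℕ)
  | .sval v => v.fv
  | .var x => {Sum.inl x}
def Trm.fv : Trm → Finset (ℕ ⊕ ℕ)
  | .wval V => V.fv
  | .mu α c => c.fv \ {Sum.inr α}
def FCtx.fv : FCtx → Finset (ℕ ⊕ ℕ)
  | .app t E => t.fv ∪ E.fv
  | .coconst _ => ∅
def CCtx.fv : CCtx → Finset (ℕ ⊕ ℕ)
  | .fctx F => F.fv
  | .covar α => {Sum.inr α}
  | .mutil x F τ => (τ.fv ∪ (F.fv \ τ.dom)) \ {Sum.inl x}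
def ECtx.fv : ECtx → Finset (ℕ ⊕ ℕ)
  | .cctx E => E.fv
  | .mut x c => c.fv \ {Sum.inl x}
def Cmd.fv : Cmd → Finset (ℕ ⊕ ℕ)
  | .cut t e => t.fv ∪ e.fv
def Store.fv : Store → Finset (ℕ ⊕ ℕ)
  | .nil => ∅
  | .consT τ x t => τ.fv ∪ (t.fv \ τ.dom)
  | .consE τ α E => τ.fv ∪ (E.fv \ τ.dom)
end

/-- Concatenation ττ′ of stores. -/
def Store.app : Store → Store → Store
  | τ, .nil => τ
  | τ, .consT τ' x t => .consT (τ.app τ') x t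
  | τ, .consE τ' α E => .consE (τ.app τ') α E

/-- Lookup of the (most recent) binding of a (co-)variable in a store. -/
def Store.lookup : Store → ℕ ⊕ ℕ → Option (Trm ⊕ CCtx)
  | .nil, _ => none
  | .consT τ x t, k => if k = Sum.inl x then some (Sum.inl t) else τ.lookup k
  | .consE τ α E, k => if k = Sum.inr α then some (Sum.inr E) else τ.lookup k

/-- A store is closed when it has no free variable. -/
def Store.Closed (τ : Store) : Prop := τ.fv = ∅

/-- Compatibility τ◇τ′: the bindings of τ and τ′ coincide on dom(τ)∩dom(τ′). -/
def Compat (τ τ' : Store) : Prop :=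
  ∀ k, k ∈ τ.dom → k ∈ τ'.dom → τ.lookup k = τ'.lookup k

/-- Store extension τ◁τ′: dom(τ)⊆dom(τ′) and τ◇τ′. -/
def Ext (τ τ' : Store) : Prop := τ.dom ⊆ τ'.dom ∧ Compat τ τ'

/-- A single binding of a store. -/
inductive Bnd : Type
  | bt : ℕ → Trm → Bnd
  | be : ℕ → CCtx → Bnd

def Bnd.key : Bnd → ℕ ⊕ ℕ
  | .bt x _ => Sum.inl x
  | .be α _ => Sum.inr α

/-- The list of bindings of a store, oldest first. -/
def Store.toL : Store → List Bnd
  | .nil => []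
  | .consT τ x t => τ.toL ++ [.bt x t]
  | .consE τ α E => τ.toL ++ [.be α E]

/-- Rebuild a store from its list of bindings (oldest first). -/
def Store.ofL : List Bnd → Store :=
  List.foldl (fun τ b => match b with
    | .bt x t => .consT τ x t
    | .be α E => .consE τ α E) .nil

/-- Split a list of bindings at the first binding of the given key,
returning the (strict) prefix and the suffix. -/
def splitAtKey (k : ℕ ⊕ ℕ) : List Bnd → Option (List Bnd × List Bnd)
  | [] => none
  | b :: l =>
    if b.key = k then some ([], l)
    else (splitAtKey k l).map (fun p => (b :: p.1, p.2))

/-- The compatible union on lists of bindings: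
(τ₀[x:=t]τ₁)⋈(τ₀′[x:=t]τ₁′) = τ₀τ₀′[x:=t](τ₁⋈τ₁′) when τ₀#τ₀′,
and τ⋈τ′ = ττ′ when τ#τ′. -/
def joinL : List Bnd → List Bnd → List Bnd
  | [], l' => l'
  | b :: l, l' =>
    match splitAtKey b.key l' with
    | some (p, s) => p ++ b :: joinL l s
    | none => b :: joinL l l'

/-- The compatible union τ̄τ′ of two (compatible closed) stores. -/
def Store.join (τ τ' : Store) : Store := .ofL (joinL τ.toL τ'.toL)

/-- Closures cτ. -/
abbrev Closure := Cmd × Store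

/-- The reduction → of the λ̄[lvτ⋆]-calculus. -/
inductive Red : Closure → Closure → Prop
  | beta (x : ℕ) (t u : Trm) (E : CCtx) (τ : Store) :
      Red (.cut (ofS (.lam x t)) (ofF (.app u E)), τ)
          (.cut u (.mut x (.cut t (ofC E))), τ)
  | lett (t : Trm) (x : ℕ) (c : Cmd) (τ : Store) :
      Red (.cut t (.mut x c), τ) (c, .consT τ x t)
  | catch (α : ℕ) (c : Cmd) (E : CCtx) (τ : Store) :
      Red (.cut (.mu α c) (ofC E), τ) (c, .consE τ α E)
  | lookupA (V : WVal) (α : ℕ) (E : CCtx) (τ τ' : Store) :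
      Red (.cut (ofW V) (ofC (.covar α)), (Store.consE τ α E).app τ')
          (.cut (ofW V) (ofC E), (Store.consE τ α E).app τ')
  | lookupX (x : ℕ) (F : FCtx) (t : Trm) (τ τ' : Store) :
      Red (.cut (ofW (.var x)) (ofF F), (Store.consT τ x t).app τ')
          (.cut t (ofC (.mutil x F τ')), τ)
  | restore (V : WVal) (x : ℕ) (F : FCtx) (τ τ' : Store) :
      Red (.cut (ofW V) (ofC (.mutil x F τ')), τ)
          (.cut (ofW V) (ofF F), (Store.consT τ x (ofW V)).app τ')

/-- A closure normalizes when there is no infinite reduction sequence from it. -/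
def Normalizes (l : Closure) : Prop :=
  ¬ ∃ f : ℕ → Closure, f 0 = l ∧ ∀ n, Red (f n) (f (n + 1))

/-- Closed closures: the store is closed and covers the free variables
of the command. -/
def InC0 (l : Closure) : Prop := l.2.Closed ∧ l.1.fv ⊆ l.2.dom

/-- Entries of typing contexts: x:A or α:A⊥⊥. -/
inductive CEntry : Type
  | tv : ℕ → Ty → CEntry
  | cv : ℕ → Ty → CEntry
deriving DecidableEq

/-- Typing contexts Γ (as lists, written left to right). -/
abbrev Ctx := List CEntry

/- The typing judgments, parameterized by signatures cs (constants) and ks (co-constants). -/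
mutual
inductive Tv (cs : ℕ → ℕ) (ks : ℕ → Ty) : Ctx → SVal → Ty → Prop
  | const {Γ : Ctx} (k : ℕ) : Tv cs ks Γ (.const k) (.atom (cs k))
  | lam {Γ : Ctx} {x : ℕ} {t : Trm} {A B : Ty} :
      Tt cs ks (Γ ++ [.tv x A]) t B → Tv cs ks Γ (.lam x t) (.arrow A B)
inductive TV (cs : ℕ → ℕ) (ks : ℕ → Ty) : Ctx → WVal → Ty → Prop
  | var {Γ : Ctx} {x : ℕ} {A : Ty} : CEntry.tv x A ∈ Γ → TV cs ks Γ (.var x) A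
  | sval {Γ : Ctx} {v : SVal} {A : Ty} : Tv cs ks Γ v A → TV cs ks Γ (.sval v) A
inductive Tt (cs : ℕ → ℕ) (ks : ℕ → Ty) : Ctx → Trm → Ty → Prop
  | wval {Γ : Ctx} {V : WVal} {A : Ty} : TV cs ks Γ V A → Tt cs ks Γ (.wval V) A
  | mu {Γ : Ctx} {α : ℕ} {c : Cmd} {A : Ty} :
      Tc cs ks (Γ ++ [.cv α A]) c → Tt cs ks Γ (.mu α c) A
inductive TF (cs : ℕ → ℕ) (ks : ℕ → Ty) : Ctx → FCtx → Ty → Prop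
  | coconst {Γ : Ctx} (κ : ℕ) : TF cs ks Γ (.coconst κ) (ks κ)
  | app {Γ : Ctx} {t : Trm} {E : CCtx} {A B : Ty} :
      Tt cs ks Γ t A → TE cs ks Γ E B → TF cs ks Γ (.app t E) (.arrow A B)
inductive TE (cs : ℕ → ℕ) (ks : ℕ → Ty) : Ctx → CCtx → Ty → Prop
  | covar {Γ : Ctx} {α : ℕ} {A : Ty} : CEntry.cv α A ∈ Γ → TE cs ks Γ (.covar α) A
  | fctx {Γ : Ctx} {F : FCtx} {A : Ty} : TF cs ks Γ F A → TE cs ks Γ (.fctx F) A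
  | mutil {Γ Γ' : Ctx} {x : ℕ} {F : FCtx} {τ : Store} {A : Ty} :
      TF cs ks (Γ ++ [.tv x A] ++ Γ') F A → Tτ cs ks Γ τ Γ' →
      TE cs ks Γ (.mutil x F τ) A
inductive Te (cs : ℕ → ℕ) (ks : ℕ → Ty) : Ctx → ECtx → Ty → Prop
  | cctx {Γ : Ctx} {E : CCtx} {A : Ty} : TE cs ks Γ E A → Te cs ks Γ (.cctx E) A
  | mut {Γ : Ctx} {x : ℕ} {c : Cmd} {A : Ty} :
      Tc cs ks (Γ ++ [.tv x A]) c → Te cs ks Γ (.mut x c) A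
inductive Tc (cs : ℕ → ℕ) (ks : ℕ → Ty) : Ctx → Cmd → Prop
  | cut {Γ : Ctx} {t : Trm} {e : ECtx} {A : Ty} :
      Tt cs ks Γ t A → Te cs ks Γ e A → Tc cs ks Γ (.cut t e)
inductive Tτ (cs : ℕ → ℕ) (ks : ℕ → Ty) : Ctx → Store → Ctx → Prop
  | nil {Γ : Ctx} : Tτ cs ks Γ .nil []
  | consT {Γ Γ' : Ctx} {τ : Store} {x : ℕ} {t : Trm} {A : Ty} :
      Tτ cs ks Γ τ Γ' → Tt cs ks (Γ ++ Γ') t A →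
      Tτ cs ks Γ (.consT τ x t) (Γ' ++ [.tv x A])
  | consE {Γ Γ' : Ctx} {τ : Store} {α : ℕ} {E : CCtx} {A : Ty} :
      Tτ cs ks Γ τ Γ' → TE cs ks (Γ ++ Γ') E A →
      Tτ cs ks Γ (.consE τ α E) (Γ' ++ [.cv α A])
end

/-- Judgment Γ ⊢l cτ for closures. -/
def Tl (cs : ℕ → ℕ) (ks : ℕ → Ty) (Γ : Ctx) (c : Cmd) (τ : Store) : Prop :=
  ∃ Γ', Tc cs ks (Γ ++ Γ') c ∧ Tτ cs ks Γ τ Γ'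

/- No occurrence of a co-constant. -/
mutual
def SVal.noco : SVal → Prop
  | .lam _ t => t.noco
  | .const _ => True
def WVal.noco : WVal → Prop
  | .sval v => v.noco
  | .var _ => True
def Trm.noco : Trm → Prop
  | .wval V => V.noco
  | .mu _ c => c.noco
def FCtx.noco : FCtx → Prop
  | .app t E => t.noco ∧ E.noco
  | .coconst _ => False
def CCtx.noco : CCtx → Prop
  | .fctx F => F.noco
  | .covar _ => True
  | .mutil _ F τ => F.noco ∧ τ.noco
def ECtx.noco : ECtx → Prop
  | .cctx E => E.noco
  | .mut _ c => c.noco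
def Cmd.noco : Cmd → Prop
  | .cut t e => t.noco ∧ e.noco
def Store.noco : Store → Prop
  | .nil => True
  | .consT τ _ t => τ.noco ∧ t.noco
  | .consE τ _ E => τ.noco ∧ E.noco
end

/-- A pole: a set of closed closures closed by anti-reduction and
by store extension. -/
structure Pole where
  mem : Closure → Prop
  mem_c0 : ∀ l, mem l → InC0 l
  anti : ∀ l l', InC0 l → InC0 l' → Red l l' → mem l' → mem l
  store_ext : ∀ c τ τ', mem (c, τ) → Ext τ τ' → Store.Closed τ' → mem (c, τ')

/-- Orthogonality (t|τ)⊥⊥(e|τ′): τ◇τ′ and ⟨t‖e⟩(τ̄τ′)∈⊥⊥. -/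
def Pole.ortho (P : Pole) (t : Trm) (τ : Store) (e : ECtx) (τ' : Store) : Prop :=
  Compat τ τ' ∧ P.mem (.cut t e, τ.join τ')

/-- The pair is a closed (term/context)-in-store: τ is closed and covers fv. -/
def CT (fv : Finset (ℕ ⊕ ℕ)) (τ : Store) : Prop := τ.Closed ∧ fv ⊆ τ.dom

/-- Forcing contexts orthogonal to a set of strong values. -/
def orthFv (P : Pole) (S : Set (SVal × Store)) : Set (FCtx × Store) :=
  {Fτ | CT Fτ.1.fv Fτ.2 ∧
    ∀ v τ', (v, τ') ∈ S → Compat Fτ.2 τ' → P.ortho (ofS v) τ' (ofF Fτ.1) Fτ.2}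

/-- Weak values orthogonal to a set of forcing contexts. -/
def orthVF (P : Pole) (S : Set (FCtx × Store)) : Set (WVal × Store) :=
  {Vτ | CT Vτ.1.fv Vτ.2 ∧
    ∀ F τ', (F, τ') ∈ S → Compat Vτ.2 τ' → P.ortho (ofW Vτ.1) Vτ.2 (ofF F) τ'}

/-- Catchable contexts orthogonal to a set of weak values. -/
def orthEV (P : Pole) (S : Set (WVal × Store)) : Set (CCtx × Store) :=
  {Eτ | CT Eτ.1.fv Eτ.2 ∧
    ∀ V τ', (V, τ') ∈ S → Compat Eτ.2 τ' → P.ortho (ofW V) τ' (ofC Eτ.1) Eτ.2}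

/-- Terms orthogonal to a set of catchable contexts. -/
def orthtE (P : Pole) (S : Set (CCtx × Store)) : Set (Trm × Store) :=
  {tτ | CT tτ.1.fv tτ.2 ∧
    ∀ E τ', (E, τ') ∈ S → Compat tτ.2 τ' → P.ortho tτ.1 tτ.2 (ofC E) τ'}

/-- Evaluation contexts orthogonal to a set of terms. -/
def orthet (P : Pole) (S : Set (Trm × Store)) : Set (ECtx × Store) :=
  {eτ | CT eτ.1.fv eτ.2 ∧
    ∀ t τ', (t, τ') ∈ S → Compat eτ.2 τ' → P.ortho t τ' eτ.1 eτ.2}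

/-- The realizer sets |A|_v at strong-value level, by induction on A. -/
def Realv (cs : ℕ → ℕ) (P : Pole) : Ty → Set (SVal × Store)
  | .atom n => {vτ | CT vτ.1.fv vτ.2 ∧ ∃ k, vτ.1 = .const k ∧ cs k = n}
  | .arrow A B =>
    {vτ | CT vτ.1.fv vτ.2 ∧ ∃ x t, vτ.1 = .lam x t ∧
      ∀ u τ', Compat vτ.2 τ' →
        (u, τ') ∈ orthtE P (orthEV P (orthVF P (orthFv P (Realv cs P A)))) →
        (t, .consT (vτ.2.join τ') x u) ∈
          orthtE P (orthEV P (orthVF P (orthFv P (Realv cs P B))))}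

/-- ‖A‖_F. -/
def RealF (cs : ℕ → ℕ) (P : Pole) (A : Ty) : Set (FCtx × Store) :=
  orthFv P (Realv cs P A)
/-- |A|_V. -/
def RealV (cs : ℕ → ℕ) (P : Pole) (A : Ty) : Set (WVal × Store) :=
  orthVF P (RealF cs P A)
/-- ‖A‖_E. -/
def RealE (cs : ℕ → ℕ) (P : Pole) (A : Ty) : Set (CCtx × Store) :=
  orthEV P (RealV cs P A)
/-- |A|_t. -/
def Realt (cs : ℕ → ℕ) (P : Pole) (A : Ty) : Set (Trm × Store) :=
  orthtE P (RealE cs P A)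
/-- ‖A‖_e. -/
def Reale (cs : ℕ → ℕ) (P : Pole) (A : Ty) : Set (ECtx × Store) :=
  orthet P (Realt cs P A)

/-- τ ⊨ Γ : the closed store τ realizes the typing context Γ. -/
def RealsCtx (cs : ℕ → ℕ) (P : Pole) (τ : Store) (Γ : Ctx) : Prop :=
  τ.Closed ∧
  (∀ x A, CEntry.tv x A ∈ Γ →
    ∃ τ₀ t τ₁, τ = (Store.consT τ₀ x t).app τ₁ ∧ (t, τ₀) ∈ Realt cs P A) ∧
  (∀ α A, CEntry.cv α A ∈ Γ →
    ∃ τ₀ E τ₁, τ = (Store.consE τ₀ α E).app τ₁ ∧ (E, τ₀) ∈ RealE cs P A)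

end LLV

namespace LLV

/-- Realizer lemma for μ-abstraction: if for every (E|τ′) ∈ ‖A‖_E compatible
with τ the closure c(τ̄τ′)[α:=E] is in the pole, then (μα.c|τ) ∈ |A|_t. -/
theorem mu_realizer (cs : ℕ → ℕ) (P : Pole) (A : Ty)
    (τ : Store) (α : ℕ) (c : Cmd)
    (hτ : τ.Closed) (hfv : (Trm.mu α c).fv ⊆ τ.dom)
    (h : ∀ (E : CCtx) (τ' : Store), (E, τ') ∈ RealE cs P A → Compat τ τ' →
      P.mem (c, Store.consE (τ.join τ') α E)) :
    (Trm.mu α c, τ) ∈ Realt cs P A := by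
  refine ⟨⟨hτ, hfv⟩, fun E τ' hE hcompat => ⟨hcompat, ?_⟩⟩
  have hmem := h E τ' hE hcompat
  have hc0 := P.mem_c0 _ hmem
  refine P.anti _ _ ?_ hc0 (Red.catch α c E (τ.join τ')) hmem
  obtain ⟨hclosed, hsub⟩ := hc0
  simp only [Store.Closed, Store.fv, Finset.union_eq_empty, Finset.sdiff_eq_empty_iff_subset]
    at hclosed
  refine ⟨hclosed.1, ?_⟩
  simp only [Cmd.fv, Trm.fv, ofC, ECtx.fv]
  refine Finset.union_subset (fun k hk => ?_) hclosed.2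
  rw [Finset.mem_sdiff, Finset.mem_singleton] at hk
  exact Finset.mem_of_mem_insert_of_ne (hsub hk.1) hk.2

end LLV
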